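/- arXiv:2304.04588 — 2 statements merged into one kernel-verified Lean document; each statement's English description precedes it below -/
import Mathlib

section
/- Let M be an invertible complex n×n matrix (n a nonempty finite index type) and c ∈ ℂ a scalar such that M · conj(M) = c · 1, where conj(M) is the entrywise complex conjugate of M and 1 is the identity matrix. Then c is real (Im c = 0). -/
open Matrix

/-- If `M` is an invertible complex matrix and
`M * conj M = c • 1` for a scalar `c`, then `c` is real.  (The time-reversal
index `β(𝒯)` of a symmetric matrix product state is a real scalar.) -/
theorem time_reversal_index_is_real
    {n : Type*} [Fintype n] [Nonempty n] [DecidableEq n]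
    (M : Matrix n n ℂ) (hM : IsUnit M) (c : ℂ)
    (h : M * M.map (starRingEnd ℂ) = c • (1 : Matrix n n ℂ)) :
    c.im = 0 := by
  have key : star (trace (M * M.map (starRingEnd ℂ))) = trace (M * M.map (starRingEnd ℂ)) := by
    simp only [trace, diag_apply, mul_apply, map_apply, star_sum, star_mul']
    rw [Finset.sum_comm]
    refine Finset.sum_congr rfl fun i _ => Finset.sum_congr rfl fun j _ => ?_
    simp [mul_comm]
  rw [h, trace_smul, trace_one, smul_eq_mul, star_mul', star_natCast] at key
  have hc : star c = c := mul_right_cancel₀ (Nat.cast_ne_zero.mpr Fintype.card_ne_zero) key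
  exact Complex.conj_eq_iff_im.mp hc
end

section
/- Let M be a unitary complex n×n matrix (n a nonempty finite index type) and c ∈ ℂ a scalar such that M · conj(M) = c · 1, where conj(M) is the entrywise complex conjugate of M and 1 is the identity matrix. Then c = 1 or c = −1. -/
open Matrix

/-- If `M` is a unitary complex matrix and
`M * conj M = c • 1` for a scalar `c`, then `c = 1` or `c = −1`.
(The time-reversal index `β(𝒯)` takes only the values `±1`.) -/
theorem time_reversal_index_pm_one
    {n : Type*} [Fintype n] [Nonempty n] [DecidableEq n]
    (M : Matrix n n ℂ) (hM : Mᴴ * M = 1) (c : ℂ)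
    (h : M * M.map (starRingEnd ℂ) = c • (1 : Matrix n n ℂ)) :
    c = 1 ∨ c = -1 := by
  have hconj : M.map (starRingEnd ℂ) = c • Mᴴ := by
    calc M.map (starRingEnd ℂ) = Mᴴ * (M * M.map (starRingEnd ℂ)) := by
          rw [← Matrix.mul_assoc, hM, Matrix.one_mul]
      _ = c • Mᴴ := by rw [h, Matrix.mul_smul, Matrix.mul_one]
  have hstar : Mᴴ = c • M.map (starRingEnd ℂ) := congrArg transpose hconj
  have hsq : (c * c) • (1 : Matrix n n ℂ) = 1 := by
    rw [← hM, ← Matrix.smul_mul, mul_smul, ← hconj, ← hstar]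
  obtain ⟨i⟩ := ‹Nonempty n›
  have hcc : c * c = 1 := by simpa using congrFun (congrFun hsq i) i
  exact mul_self_eq_one_iff.mp hcc
end
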